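/- arXiv:1905.03047 — 4 statements merged into one kernel-verified Lean document; each statement's English description precedes it below -/
import Mathlib

section
/- Let n ≥ 5 and let a, b ∈ ℂⁿ have all Plücker coordinates P_{ij} nonzero for i ≠ j. Define z_l = w_{1,2,3,l} = (P_{13} P_{2l})/(P_{1l} P_{23}) for l ∈ {4,…,n}. Then z_k ≠ z_l whenever 4 ≤ k < l ≤ n. (Moreover each z_l ≠ 0 and z_l ≠ 1.) -/
/-- The Plücker coordinate `P_{ij} = a_i b_j - a_j b_i` of a pair of vectors. -/
noncomputable def plucker (a b : ℕ → ℂ) (i j : ℕ) : ℂ :=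
  a i * b j - a j * b i

/-- The cross-ratio `w_{i,j,k,l} = (P_{ik} P_{jl}) / (P_{il} P_{jk})`. -/
noncomputable def crossRatio (a b : ℕ → ℂ) (i j k l : ℕ) : ℂ :=
  (plucker a b i k * plucker a b j l) / (plucker a b i l * plucker a b j k)

/-- The three-term Plücker relation. -/
theorem plucker_relation (a b : ℕ → ℂ) (i j k l : ℕ) :
    plucker a b i k * plucker a b j l - plucker a b i l * plucker a b j k =
      plucker a b i j * plucker a b k l := by
  unfold plucker
  ring

/-- On the main stratum of `G_{n,2}` the coordinates `z_l = w_{1,2,3,l}`, `l = 4,…,n`,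
are pairwise distinct, and each is different from `0` and `1`. -/
theorem z_coords_distinct (n : ℕ) (hn : 5 ≤ n) (a b : ℕ → ℂ)
    (hP : ∀ i j : ℕ, 1 ≤ i → i ≤ n → 1 ≤ j → j ≤ n → i ≠ j → plucker a b i j ≠ 0) :
    (∀ k l : ℕ, 4 ≤ k → k < l → l ≤ n →
      crossRatio a b 1 2 3 k ≠ crossRatio a b 1 2 3 l) ∧
    (∀ l : ℕ, 4 ≤ l → l ≤ n →
      crossRatio a b 1 2 3 l ≠ 0 ∧ crossRatio a b 1 2 3 l ≠ 1) := by
  have h12 : plucker a b 1 2 ≠ 0 := hP 1 2 (by omega) (by omega) (by omega) (by omega) (by omega)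
  have h13 : plucker a b 1 3 ≠ 0 := hP 1 3 (by omega) (by omega) (by omega) (by omega) (by omega)
  have h23 : plucker a b 2 3 ≠ 0 := hP 2 3 (by omega) (by omega) (by omega) (by omega) (by omega)
  have hne : ∀ i l : ℕ, 1 ≤ i → i < l → l ≤ n → plucker a b i l ≠ 0 := fun i l hi hil hl =>
    hP i l hi (by omega) (by omega) hl (by omega)
  refine ⟨fun k l hk hkl hl h => ?_, fun l hl hln => ⟨?_, fun h => ?_⟩⟩
  · have h1k := hne 1 k le_rfl (by omega) (by omega)
    have h1l := hne 1 l le_rfl (by omega) hl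
    unfold crossRatio at h
    rw [div_eq_div_iff (mul_ne_zero h1k h23) (mul_ne_zero h1l h23)] at h
    refine mul_ne_zero (mul_ne_zero h13 h23)
      (mul_ne_zero h12 (hne k l (by omega) hkl hl)) ?_
    rw [← plucker_relation a b 1 2 k l]
    linear_combination -h
  · have h1l := hne 1 l le_rfl (by omega) hln
    have h2l := hne 2 l (by omega) (by omega) hln
    exact div_ne_zero (mul_ne_zero h13 h2l) (mul_ne_zero h1l h23)
  · have h1l := hne 1 l le_rfl (by omega) hln
    unfold crossRatio at h
    rw [div_eq_one_iff_eq (mul_ne_zero h1l h23)] at h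
    refine mul_ne_zero h12 (hne 3 l (by omega) (by omega) hln) ?_
    rw [← plucker_relation, h, sub_self]
end

section
/- Let n ≥ 6 and let a, b ∈ ℂⁿ have all Plücker coordinates P_{ij} nonzero for i ≠ j. Set z_l = w_{1,2,3,l} for l ∈ {4,…,n}, so that z_i ≠ 0, z_i ≠ 1 and z_i ≠ z_j for distinct i, j ∈ {4,…,n}. Then for all pairwise distinct i, j, k ∈ {4,…,n}: (1) w_{1,i,j,k} = (z_i − z_k)/(z_i − z_j); (2) w_{2,i,j,k} = z_j (z_i − z_k)/(z_k (z_i − z_j)); (3) w_{3,i,j,k} = (1 − z_j)(z_i − z_k)/((1 − z_k)(z_i − z_j)). -/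
/-- The difference of two cross-ratios sharing their first three indices. -/
theorem crossRatio_sub_crossRatio {a b : ℕ → ℂ} {p q r l m : ℕ}
    (hqr : plucker a b q r ≠ 0) (hpl : plucker a b p l ≠ 0) (hpm : plucker a b p m ≠ 0) :
    crossRatio a b p q r l - crossRatio a b p q r m =
      -(plucker a b p q * plucker a b p r * plucker a b l m) /
        (plucker a b q r * plucker a b p l * plucker a b p m) := by
  unfold crossRatio
  field_simp
  unfold plucker
  ring

/-- The complement of a cross-ratio is again a quotient of products of Plücker coordinates. -/
theorem one_sub_crossRatio {a b : ℕ → ℂ} {p q r l : ℕ}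
    (hqr : plucker a b q r ≠ 0) (hpl : plucker a b p l ≠ 0) :
    1 - crossRatio a b p q r l =
      -(plucker a b p q * plucker a b r l) / (plucker a b q r * plucker a b p l) := by
  unfold crossRatio
  field_simp
  unfold plucker
  ring

/-- On the main stratum of `G_{n,2}`, with `z_l = w_{1,2,3,l}`, the cross-ratios
`w_{1,i,j,k}`, `w_{2,i,j,k}` and `w_{3,i,j,k}` are expressed via `z_i, z_j, z_k`. -/
theorem crossRatio_one_small_index (n : ℕ) (hn : 6 ≤ n) (a b : ℕ → ℂ)
    (hP : ∀ i j : ℕ, 1 ≤ i → i ≤ n → 1 ≤ j → j ≤ n → i ≠ j → plucker a b i j ≠ 0) :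
    ∀ i j k : ℕ, 4 ≤ i → i ≤ n → 4 ≤ j → j ≤ n → 4 ≤ k → k ≤ n →
      i ≠ j → i ≠ k → j ≠ k →
      crossRatio a b 1 i j k =
        (crossRatio a b 1 2 3 i - crossRatio a b 1 2 3 k)
          / (crossRatio a b 1 2 3 i - crossRatio a b 1 2 3 j) ∧
      crossRatio a b 2 i j k =
        crossRatio a b 1 2 3 j * (crossRatio a b 1 2 3 i - crossRatio a b 1 2 3 k)
          / (crossRatio a b 1 2 3 k * (crossRatio a b 1 2 3 i - crossRatio a b 1 2 3 j)) ∧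
      crossRatio a b 3 i j k =
        (1 - crossRatio a b 1 2 3 j) * (crossRatio a b 1 2 3 i - crossRatio a b 1 2 3 k)
          / ((1 - crossRatio a b 1 2 3 k)
              * (crossRatio a b 1 2 3 i - crossRatio a b 1 2 3 j)) := by
  intro i j k hi hin hj hjn hk hkn hij hik hjk
  have h12 := hP 1 2 (by omega) (by omega) (by omega) (by omega) (by omega)
  have h13 := hP 1 3 (by omega) (by omega) (by omega) (by omega) (by omega)
  have h23 := hP 2 3 (by omega) (by omega) (by omega) (by omega) (by omega)
  have h1i := hP 1 i (by omega) (by omega) (by omega) hin (by omega)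
  have h1j := hP 1 j (by omega) (by omega) (by omega) hjn (by omega)
  have h1k := hP 1 k (by omega) (by omega) (by omega) hkn (by omega)
  have h2j := hP 2 j (by omega) (by omega) (by omega) hjn (by omega)
  have h2k := hP 2 k (by omega) (by omega) (by omega) hkn (by omega)
  have h3k := hP 3 k (by omega) (by omega) (by omega) hkn (by omega)
  have hPij := hP i j (by omega) hin (by omega) hjn hij
  rw [crossRatio_sub_crossRatio h23 h1i h1k, crossRatio_sub_crossRatio h23 h1i h1j,
    one_sub_crossRatio h23 h1j, one_sub_crossRatio h23 h1k]
  unfold crossRatio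
  refine ⟨?_, ?_, ?_⟩ <;> field_simp
end

section
/- Let n ≥ 4 and let z_4, …, z_n ∈ ℂ be such that z_l ≠ 0, z_l ≠ 1 for every l ∈ {4,…,n}, and z_k ≠ z_l for all distinct k, l ∈ {4,…,n}. Then there exist vectors a, b ∈ ℂⁿ such that all Plücker coordinates P_{ij} = a_i b_j − a_j b_i are nonzero for i ≠ j and w_{1,2,3,l} = (P_{13} P_{2l})/(P_{1l} P_{23}) = z_l for every l ∈ {4,…,n}. Hence the space of parameters F of the main stratum of G_{n,2} is, in the coordinates z_4,…,z_n, exactly the subset of ℂ^{n−3} defined by the inequalities z_i ≠ 0, z_i ≠ 1 and z_i ≠ z_j. -/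
/-- Every tuple `(z_4, …, z_n)` with `z_l ≠ 0, 1` and `z_k ≠ z_l` is realized by a point of
the main stratum of `G_{n,2}` via the coordinates `z_l = w_{1,2,3,l}`; i.e. the space of
parameters of the main stratum is exactly the subset of `ℂ^{n-3}` defined by
`z_i ≠ 0`, `z_i ≠ 1`, `z_i ≠ z_j`. -/
theorem main_stratum_parameters_onto (n : ℕ) (hn : 4 ≤ n) (z : ℕ → ℂ)
    (hz0 : ∀ l : ℕ, 4 ≤ l → l ≤ n → z l ≠ 0)
    (hz1 : ∀ l : ℕ, 4 ≤ l → l ≤ n → z l ≠ 1)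
    (hzd : ∀ k l : ℕ, 4 ≤ k → k ≤ n → 4 ≤ l → l ≤ n → k ≠ l → z k ≠ z l) :
    ∃ a b : ℕ → ℂ,
      (∀ i j : ℕ, 1 ≤ i → i ≤ n → 1 ≤ j → j ≤ n → i ≠ j → plucker a b i j ≠ 0) ∧
      ∀ l : ℕ, 4 ≤ l → l ≤ n → crossRatio a b 1 2 3 l = z l := by
  refine ⟨fun i => if i = 1 then 1 else if i = 2 then 0 else if i = 3 then 1 else z i,
    fun i => if i = 1 then 0 else 1, fun i j hi hin hj hjn hij => ?_, fun l hl hln => ?_⟩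
  · have eq_or_four_le (m : ℕ) (hm : 1 ≤ m) : m = 1 ∨ m = 2 ∨ m = 3 ∨ 4 ≤ m := by omega
    rw [plucker]
    rcases eq_or_four_le i hi with rfl | rfl | rfl | hi4 <;>
      rcases eq_or_four_le j hj with rfl | rfl | rfl | hj4 <;> grind
  · simp [crossRatio, plucker, show l ≠ 1 by omega, show l ≠ 2 by omega, show l ≠ 3 by omega]
end

section
/- Let n ≥ 4 and let a, b, c, d ∈ ℂⁿ be such that all Plücker coordinates P_{ij}(L) = a_i b_j − a_j b_i and P_{ij}(M) = c_i d_j − c_j d_i are nonzero for i ≠ j. Suppose that w_{1,2,3,l}(L) = w_{1,2,3,l}(M) for every l ∈ {4,…,n}, i.e. P_{13}(L) P_{2l}(L) P_{1l}(M) P_{23}(M) = P_{1l}(L) P_{23}(L) P_{13}(M) P_{2l}(M) for all l. Then there exists t = (t_1,…,t_n) ∈ (ℂ*)ⁿ with P_{ij}(M) = t_i t_j P_{ij}(L) for all i, j; that is, the values z_l = w_{1,2,3,l}, l = 4,…,n, determine a point of the main stratum of G_{n,2} uniquely up to the action of the algebraic torus (ℂ*)ⁿ. -/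
theorem plucker_self (a b : ℕ → ℂ) (i : ℕ) : plucker a b i i = 0 := by
  simp [plucker]

theorem plucker_swap (a b : ℕ → ℂ) (i j : ℕ) : plucker a b j i = -plucker a b i j := by
  simp [plucker]

/-- The three-term Plücker relation. -/
theorem plucker_mul_plucker (a b : ℕ → ℂ) (k l i j : ℕ) :
    plucker a b k l * plucker a b i j
      = plucker a b k i * plucker a b l j - plucker a b k j * plucker a b l i := by
  simp only [plucker]
  ring

/-- If `t` rescales the Plücker coordinates involving `k` or `l`, it rescales all of them. -/
theorem plucker_eq_of_rescaled {a b c d t : ℕ → ℂ} {k l i j : ℕ}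
    (hkl : plucker c d k l ≠ 0) (h : plucker c d k l = t k * t l * plucker a b k l)
    (hki : plucker c d k i = t k * t i * plucker a b k i)
    (hkj : plucker c d k j = t k * t j * plucker a b k j)
    (hli : plucker c d l i = t l * t i * plucker a b l i)
    (hlj : plucker c d l j = t l * t j * plucker a b l j) :
    plucker c d i j = t i * t j * plucker a b i j := by
  apply mul_left_cancel₀ hkl
  rw [plucker_mul_plucker, hki, hkj, hli, hlj, h]
  linear_combination -(t k * t l * t i * t j) * plucker_mul_plucker a b k l i j

/-- If two points of the main stratum of `G_{n,2}` have the same coordinates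
`z_l = w_{1,2,3,l}`, `l = 4,…,n` (expressed by cross-multiplied Plücker coordinates), then
they lie in the same orbit of the algebraic torus `(ℂ*)ⁿ`. -/
theorem z_coords_determine_orbit (n : ℕ) (hn : 4 ≤ n) (a b c d : ℕ → ℂ)
    (hL : ∀ i j : ℕ, 1 ≤ i → i ≤ n → 1 ≤ j → j ≤ n → i ≠ j → plucker a b i j ≠ 0)
    (hM : ∀ i j : ℕ, 1 ≤ i → i ≤ n → 1 ≤ j → j ≤ n → i ≠ j → plucker c d i j ≠ 0)
    (hcr : ∀ l : ℕ, 4 ≤ l → l ≤ n →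
      plucker a b 1 3 * plucker a b 2 l * plucker c d 1 l * plucker c d 2 3
        = plucker a b 1 l * plucker a b 2 3 * plucker c d 1 3 * plucker c d 2 l) :
    ∃ t : ℕ → ℂ, (∀ i : ℕ, 1 ≤ i → i ≤ n → t i ≠ 0) ∧
      ∀ i j : ℕ, 1 ≤ i → i ≤ n → 1 ≤ j → j ≤ n →
        plucker c d i j = t i * t j * plucker a b i j := by
  have p12 := hL 1 2 (by omega) (by omega) (by omega) (by omega) (by omega)
  have p13 := hL 1 3 (by omega) (by omega) (by omega) (by omega) (by omega)
  have p23 := hL 2 3 (by omega) (by omega) (by omega) (by omega) (by omega)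
  have q12 := hM 1 2 (by omega) (by omega) (by omega) (by omega) (by omega)
  have q13 := hM 1 3 (by omega) (by omega) (by omega) (by omega) (by omega)
  have q23 := hM 2 3 (by omega) (by omega) (by omega) (by omega) (by omega)
  obtain ⟨s, hs⟩ := IsAlgClosed.exists_pow_nat_eq
    (plucker c d 1 2 * plucker c d 1 3 * plucker a b 2 3
      / (plucker a b 1 2 * plucker a b 1 3 * plucker c d 2 3)) (n := 2) (by norm_num)
  have s0 : s ≠ 0 := by
    rintro rfl
    rw [zero_pow two_ne_zero] at hs
    exact (by positivity : _ ≠ (0 : ℂ)) hs.symm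
  rw [eq_div_iff (by positivity)] at hs
  set t : ℕ → ℂ := fun i => if i = 1 then s else plucker c d 1 i / plucker a b 1 i / s with ht
  have t1 : t 1 = s := by simp [ht]
  have t_ne_one {i : ℕ} (hi : i ≠ 1) : t i = plucker c d 1 i / plucker a b 1 i / s := by
    simp [ht, hi]
  have row1 (i : ℕ) (h1 : 1 ≤ i) (hn' : i ≤ n) :
      plucker c d 1 i = t 1 * t i * plucker a b 1 i := by
    by_cases hi : i = 1
    · subst hi
      simp [plucker_self]
    · have := hL 1 i (by omega) (by omega) h1 hn' (Ne.symm hi)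
      rw [t1, t_ne_one hi]
      field_simp
  have row2 (i : ℕ) (h1 : 1 ≤ i) (hn' : i ≤ n) :
      plucker c d 2 i = t 2 * t i * plucker a b 2 i := by
    obtain rfl | rfl | hi : i = 1 ∨ i = 2 ∨ 3 ≤ i := by omega
    · rw [plucker_swap c d 1 2, plucker_swap a b 1 2, row1 2 (by omega) (by omega)]
      ring
    · simp [plucker_self]
    · have p1i := hL 1 i (by omega) (by omega) h1 hn' (by omega)
      have cross : plucker a b 1 3 * plucker a b 2 i * plucker c d 1 i * plucker c d 2 3
          = plucker a b 1 i * plucker a b 2 3 * plucker c d 1 3 * plucker c d 2 i := by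
        obtain rfl | hi4 : i = 3 ∨ 4 ≤ i := by omega
        · ring
        · exact hcr i hi4 hn'
      rw [t_ne_one (by omega : 2 ≠ 1), t_ne_one (by omega : i ≠ 1)]
      field_simp
      apply mul_left_cancel₀ (mul_ne_zero (mul_ne_zero p13 q23) p12)
      linear_combination
        plucker c d 2 i * plucker a b 1 i * plucker a b 1 2 * hs
          - plucker c d 1 2 * plucker a b 1 2 * cross
  refine ⟨t, fun i h1 hn' => ?_, fun i j hi hin hj hjn => ?_⟩
  · by_cases hi : i = 1
    · rwa [hi, t1]
    · rw [t_ne_one hi]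
      exact div_ne_zero (div_ne_zero (hM 1 i (by omega) (by omega) h1 hn' (Ne.symm hi))
        (hL 1 i (by omega) (by omega) h1 hn' (Ne.symm hi))) s0
  · exact plucker_eq_of_rescaled q12 (row1 2 (by omega) (by omega)) (row1 i hi hin)
      (row1 j hj hjn) (row2 i hi hin) (row2 j hj hjn)
end
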